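/- arXiv:0909.1939 — 2 statements merged into one kernel-verified Lean document; each statement's English description precedes it below -/
import Mathlib

section
/- Let a, b, bp, br, bpp, bpr, bb, bbr, k, t, kp, kr be integers satisfying: a ≥ 1, 3b > a, b = a·bp + br with bp ≥ 0, 0 ≤ br < a and br ≤ b, bp = 4·bpp + bpr with bpp ≥ 0 and 0 ≤ bpr ≤ 3, 4b = bb·(3b − a) + bbr with bb ≥ 0 and 0 ≤ bbr < 3b − a, k > N where N = 8·bb·(4·bb + 7) + 5·(bpp + 4)·(5·bpp + 12), t > k, and 2k − bpp·(bpp + 5) − 16·bb·(4·bb + 7) − 68 = 2·kp·(2·bpp + 5) + 2·kr with kp ≥ 0 and 0 ≤ kr < 2·bpp + 5. Set n = 4 + bpp, m = 2t·(27b − 9a − 4·bbr) − 2·kp + 3, and c = 2·kp − 12·bpp − 6·kr − 33. Then c ≤ 2·m·(n − 3). -/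
/-- The contraction parameter `c` of the main construction does not exceed the number
`2m(n-3)` of thick edges. -/
theorem stmt_12 (a b bp br bpp bpr bb bbr k t kp kr : ℤ)
    (ha : 1 ≤ a) (hba : a < 3 * b)
    (hdiv1 : b = a * bp + br) (hbp : 0 ≤ bp) (hbr0 : 0 ≤ br) (hbr1 : br < a) (hbr2 : br ≤ b)
    (hdiv2 : bp = 4 * bpp + bpr) (hbpp : 0 ≤ bpp) (hbpr0 : 0 ≤ bpr) (hbpr1 : bpr ≤ 3)
    (hdiv3 : 4 * b = bb * (3 * b - a) + bbr) (hbb : 0 ≤ bb) (hbbr0 : 0 ≤ bbr)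
    (hbbr1 : bbr < 3 * b - a)
    (hk : 8 * bb * (4 * bb + 7) + 5 * (bpp + 4) * (5 * bpp + 12) < k) (ht : k < t)
    (hdiv4 : 2 * k - bpp * (bpp + 5) - 16 * bb * (4 * bb + 7) - 68
      = 2 * kp * (2 * bpp + 5) + 2 * kr)
    (hkp : 0 ≤ kp) (hkr0 : 0 ≤ kr) (hkr1 : kr < 2 * bpp + 5)
    (n m c : ℤ) (hn : n = 4 + bpp)
    (hm : m = 2 * t * (27 * b - 9 * a - 4 * bbr) - 2 * kp + 3)
    (hc : c = 2 * kp - 12 * bpp - 6 * kr - 33) :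
    c ≤ 2 * m * (n - 3) := by
  have h_bpp : 0 ≤ bpp * (bpp + 5) := by positivity
  have h_bb : 0 ≤ bb * (4 * bb + 7) := by positivity
  have h_kp_bpp : 0 ≤ kp * bpp := by positivity
  have h_kp : 5 * kp ≤ k := by linarith
  have h_coeff : 9 ≤ 27 * b - 9 * a - 4 * bbr := by linarith
  have h_t : t * 9 ≤ t * (27 * b - 9 * a - 4 * bbr) :=
    mul_le_mul_of_nonneg_left h_coeff (by linarith)
  have h_m : 88 * kp + 3 ≤ m := by linarith
  have h_m_bpp : 0 ≤ m * bpp := mul_nonneg (by linarith) hbpp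
  subst hn
  linarith
end

section
/- Let a, b, bp, br, bpp, bpr, bb, bbr, k, t, kp, kr be integers satisfying: a ≥ 1, 3b > a, b = a·bp + br with bp ≥ 0, 0 ≤ br < a and br ≤ b, bp = 4·bpp + bpr with bpp ≥ 0 and 0 ≤ bpr ≤ 3, 4b = bb·(3b − a) + bbr with bb ≥ 0 and 0 ≤ bbr < 3b − a, k > N where N = 8·bb·(4·bb + 7) + 5·(bpp + 4)·(5·bpp + 12), t > k, and 2k − bpp·(bpp + 5) − 16·bb·(4·bb + 7) − 68 = 2·kp·(2·bpp + 5) + 2·kr with kp ≥ 0 and 0 ≤ kr < 2·bpp + 5. Set n = 4 + bpp, m = 2t·(27b − 9a − 4·bbr) − 2·kp + 3, c = 2·kp − 12·bpp − 6·kr − 33, w = bb, s = 2t·(a·(4·bpp + 9) − b), p = k − (bpp·(bpp + 23)/2 + 8·bb·(4·bb + 7) + 4·kr + 56), q = 2·bpp + kr + 5, and define D₃ = (4m(n−2) − 2c) + 4s + (4p + 3q + 2) − 4, D₄ = (m + c) + 2s, D₅ = 3q, D₆ = (4w + 3)s. Then D₃ + D₄ + D₅ + D₆ > 0 and the rational number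 (3·D₃ + 4·D₄ + 5·D₅ + 6·D₆) / (D₃ + D₄ + D₅ + D₆) equals 3 + a/b. -/
/-- The graphs in the family `Γ(n, m, c, w, s, p, q)` of the main construction have
average degree exactly `3 + a/b`, and a positive number of vertices. -/
theorem stmt_16 (a b bp br bpp bpr bb bbr k t kp kr : ℤ)
    (ha : 1 ≤ a) (hba : a < 3 * b)
    (hdiv1 : b = a * bp + br) (hbp : 0 ≤ bp) (hbr0 : 0 ≤ br) (hbr1 : br < a) (hbr2 : br ≤ b)
    (hdiv2 : bp = 4 * bpp + bpr) (hbpp : 0 ≤ bpp) (hbpr0 : 0 ≤ bpr) (hbpr1 : bpr ≤ 3)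
    (hdiv3 : 4 * b = bb * (3 * b - a) + bbr) (hbb : 0 ≤ bb) (hbbr0 : 0 ≤ bbr)
    (hbbr1 : bbr < 3 * b - a)
    (hk : 8 * bb * (4 * bb + 7) + 5 * (bpp + 4) * (5 * bpp + 12) < k) (ht : k < t)
    (hdiv4 : 2 * k - bpp * (bpp + 5) - 16 * bb * (4 * bb + 7) - 68
      = 2 * kp * (2 * bpp + 5) + 2 * kr)
    (hkp : 0 ≤ kp) (hkr0 : 0 ≤ kr) (hkr1 : kr < 2 * bpp + 5)
    (n m c w s p q D3 D4 D5 D6 : ℤ)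
    (hn : n = 4 + bpp)
    (hm : m = 2 * t * (27 * b - 9 * a - 4 * bbr) - 2 * kp + 3)
    (hc : c = 2 * kp - 12 * bpp - 6 * kr - 33)
    (hw : w = bb)
    (hs : s = 2 * t * (a * (4 * bpp + 9) - b))
    (hp : p = k - (bpp * (bpp + 23) / 2 + 8 * bb * (4 * bb + 7) + 4 * kr + 56))
    (hq : q = 2 * bpp + kr + 5)
    (hD3 : D3 = (4 * m * (n - 2) - 2 * c) + 4 * s + (4 * p + 3 * q + 2) - 4)
    (hD4 : D4 = (m + c) + 2 * s)
    (hD5 : D5 = 3 * q)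
    (hD6 : D6 = (4 * w + 3) * s) :
    0 < D3 + D4 + D5 + D6 ∧
    ((3 * D3 + 4 * D4 + 5 * D5 + 6 * D6 : ℤ) : ℚ) / ((D3 + D4 + D5 + D6 : ℤ) : ℚ)
      = 3 + (a : ℚ) / (b : ℚ) := by
  have hbpos : 0 < b := by linarith
  have hbpp_even : 2 * (bpp * (bpp + 23) / 2) = bpp * (bpp + 23) := by
    refine Int.mul_ediv_cancel' (even_iff_two_dvd.mp ?_)
    simp only [Int.even_mul, Int.even_add]
    have : ¬ Even (23 : ℤ) := by decide
    tauto
  have htpos : 0 < t := by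
    have : 0 ≤ 8 * bb * (4 * bb + 7) + 5 * (bpp + 4) * (5 * bpp + 12) := by positivity
    linarith
  have hbbr : bbr = 4 * b - bb * (3 * b - a) := by linarith
  obtain ⟨F, hF⟩ : ∃ F, F = (12 * bb + 11) * (4 * bpp + 9) - 4 * bb - 9 := ⟨_, rfl⟩
  have hFpos : 0 < F := by
    have : 0 ≤ bb * bpp := mul_nonneg hbb hbpp
    linarith
  have hvertices : D3 + D4 + D5 + D6 = 2 * t * b * F := by
    subst hF hD3 hD4 hD5 hD6 hn hm hc hw hs hp hq hbbr
    linear_combination 2 * hdiv4 - 2 * hbpp_even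
  have hexcess : D4 + 2 * D5 + 3 * D6 = 2 * t * a * F := by
    subst hF hD4 hD5 hD6 hm hc hw hs hq hbbr
    ring
  have hdegrees : 3 * D3 + 4 * D4 + 5 * D5 + 6 * D6 = 2 * t * F * (3 * b + a) := by
    linear_combination 3 * hvertices + hexcess
  rw [hdegrees, hvertices]
  refine ⟨by positivity, ?_⟩
  have hb : (b : ℚ) ≠ 0 := by exact_mod_cast hbpos.ne'
  have ht0 : (t : ℚ) ≠ 0 := by exact_mod_cast htpos.ne'
  have hF0 : (F : ℚ) ≠ 0 := by exact_mod_cast hFpos.ne'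
  push_cast
  field_simp
end
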